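/- Let A ∈ ℝ^{m×n} with rank(A) = m < n, let y ∈ ℝ^m and τ ≥ 0, and suppose Aᵀ satisfies the weak RSP of order k. Then there exists a constant γ > 0, depending only on (A, y, τ), such that for every x ∈ ℝⁿ there is an optimal solution x* of the standard Dantzig selector problem min{‖z‖₁ : ‖Aᵀ(Az − y)‖_∞ ≤ τ} with ‖x − x*‖₂ ≤ γ·{ (‖Aᵀ(Ax − y)‖_∞ − τ)⁺ + 2σ_k(x)₁ + c_A·τ + c_A·‖Aᵀ(Ax − y)‖_∞ }. In particular, for every x with ‖Aᵀ(Ax − y)‖_∞ ≤ τ, there is an optimal solution x* with ‖x − x*‖₂ ≤ 2γ·{ σ_k(x)₁ + c_A·τ }. -/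

import Mathlib

open Matrix
open scoped Classical

/-- The ℓ₁ norm on `Fin n → ℝ`. -/
noncomputable def l1norm {n : ℕ} (x : Fin n → ℝ) : ℝ := ∑ i, |x i|

/-- The Euclidean (ℓ₂) norm on `Fin n → ℝ`. -/
noncomputable def l2norm {n : ℕ} (x : Fin n → ℝ) : ℝ := Real.sqrt (∑ i, (x i) ^ 2)

/-- The ℓ_∞ norm on `Fin n → ℝ`. -/
noncomputable def linfnorm {n : ℕ} (x : Fin n → ℝ) : ℝ := ⨆ i, |x i|

/-- The best `k`-term approximation error `σ_k(x)₁`. -/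
noncomputable def bestKTerm {n : ℕ} (k : ℕ) (x : Fin n → ℝ) : ℝ :=
  sInf {t : ℝ | ∃ u : Fin n → ℝ,
    (Finset.univ.filter (fun i => u i ≠ 0)).card ≤ k ∧ t = l1norm (x - u)}

/-- `Aᵀ` satisfies the weak range space property of order `k`. -/
def WeakRSP {m n : ℕ} (A : Matrix (Fin m) (Fin n) ℝ) (k : ℕ) : Prop :=
  ∀ S₁ S₂ : Finset (Fin n), Disjoint S₁ S₂ → S₁.card + S₂.card ≤ k →
    ∃ u : Fin m → ℝ,
      (∀ i ∈ S₁, Aᵀ.mulVec u i = 1) ∧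
      (∀ i ∈ S₂, Aᵀ.mulVec u i = -1) ∧
      (∀ i, i ∉ S₁ → i ∉ S₂ → |Aᵀ.mulVec u i| ≤ 1)

/-- The induced `∞→1` operator norm. -/
noncomputable def opNormInfToOne {a b : ℕ} (Q : Matrix (Fin a) (Fin b) ℝ) : ℝ :=
  sSup {t : ℝ | ∃ x : Fin b → ℝ, linfnorm x ≤ 1 ∧ t = l1norm (Q.mulVec x)}

/-- The constant
`c_A = max {‖A_G⁻¹ (AAᵀ)⁻¹ A‖_{∞→1} : A_G an invertible m×m column-submatrix of A}`. -/
noncomputable def cA {m n : ℕ} (A : Matrix (Fin m) (Fin n) ℝ) : ℝ :=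
  sSup {t : ℝ | ∃ g : Fin m → Fin n, Function.Injective g ∧
    IsUnit (A.submatrix id g) ∧
    t = opNormInfToOne ((A.submatrix id g)⁻¹ * (A * Aᵀ)⁻¹ * A)}

open Filter Topology in
/-- A vector in the polar of the polyhedral cone `{z | ∀ i ∈ J, a i z ≤ 0}` is controlled in norm
by its largest constraint violation. -/
theorem exists_norm_le_mul_of_mem_polar {E ι : Type*} [NormedAddCommGroup E]
    [InnerProductSpace ℝ E] [FiniteDimensional ℝ E] (a : ι → E →L[ℝ] ℝ) (J : Finset ι) :
    ∃ C : ℝ, 0 < C ∧ ∀ d : E, (∀ z, (∀ i ∈ J, a i z ≤ 0) → inner ℝ d z ≤ 0) →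
      ∀ r, 0 ≤ r → (∀ i ∈ J, a i d ≤ r) → ‖d‖ ≤ C * r := by
  set f : E → ℝ := fun d => ∑ i ∈ J, max (a i d) 0 with hf
  have hfc : Continuous f := by fun_prop
  set S : Set E := Metric.sphere 0 1 ∩
    {d | ∀ z, (∀ i ∈ J, a i z ≤ 0) → inner ℝ d z ≤ 0} with hS
  have hScomp : IsCompact S := by
    refine (isCompact_sphere 0 1).inter_right ?_
    simp only [Set.ofPred_forall]
    exact isClosed_iInter fun z => isClosed_iInter fun _ =>
      isClosed_le (by fun_prop) continuous_const
  have hpos : ∀ d ∈ S, 0 < f d := by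
    rintro d ⟨hd1, hd⟩
    by_contra! hle
    have h0 : ∀ i ∈ J, max (a i d) 0 = 0 :=
      (Finset.sum_eq_zero_iff_of_nonneg fun i _ => le_max_right _ _).1
        (le_antisymm hle (Finset.sum_nonneg fun i _ => le_max_right _ _))
    have := hd d fun i hi => max_eq_right_iff.1 (h0 i hi)
    rw [real_inner_self_eq_norm_sq, mem_sphere_zero_iff_norm.1 hd1] at this
    norm_num at this
  obtain ⟨c, hc, hcS⟩ := hScomp.exists_forall_le' hfc.continuousOn hpos
  refine ⟨(J.card + 1) / c, by positivity, fun d hd r hr hdr => ?_⟩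
  rcases eq_or_ne d 0 with rfl | hd0
  · simp only [norm_zero]; positivity
  have hn : 0 < ‖d‖ := norm_pos_iff.2 hd0
  have hmem : ‖d‖⁻¹ • d ∈ S := by
    refine ⟨by simp [norm_smul, hn.ne'], fun z hz => ?_⟩
    rw [real_inner_smul_left]
    exact mul_nonpos_of_nonneg_of_nonpos (by positivity) (hd z hz)
  have hscale : f (‖d‖⁻¹ • d) = ‖d‖⁻¹ * f d := by
    simp only [hf, Finset.mul_sum, map_smul, smul_eq_mul]
    refine Finset.sum_congr rfl fun i _ => ?_
    rw [mul_max_of_nonneg _ _ (by positivity), mul_zero]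
  have h1 := hcS _ hmem
  rw [hscale, inv_mul_eq_div, le_div_iff₀ hn] at h1
  have h2 : f d ≤ J.card * r := by
    rw [← nsmul_eq_mul]
    exact Finset.sum_le_card_nsmul _ _ _ fun i hi => max_le (hdr i hi) hr
  rw [div_mul_eq_mul_div, le_div_iff₀ hc]
  nlinarith

open Filter Topology in
/-- **Hoffman's error bound** for a nonempty polyhedron. -/
theorem hoffman_error_bound {E ι : Type*} [NormedAddCommGroup E] [InnerProductSpace ℝ E]
    [FiniteDimensional ℝ E] [Fintype ι] (a : ι → E →L[ℝ] ℝ) (b : ι → ℝ)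
    (hne : {z | ∀ i, a i z ≤ b i}.Nonempty) :
    ∃ C : ℝ, 0 < C ∧ ∀ x r, 0 ≤ r → (∀ i, a i x ≤ b i + r) →
      ∃ p, (∀ i, a i p ≤ b i) ∧ ‖x - p‖ ≤ C * r := by
  choose C hC hCJ using exists_norm_le_mul_of_mem_polar a
  refine ⟨∑ J, C J, Finset.sum_pos (fun J _ => hC J) ⟨∅, Finset.mem_univ _⟩,
    fun x r hr hx => ?_⟩
  set P : Set E := {z | ∀ i, a i z ≤ b i} with hP
  have hclosed : IsClosed P := by
    simp only [hP, Set.ofPred_forall]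
    exact isClosed_iInter fun i => isClosed_le (by fun_prop) continuous_const
  have hconv : Convex ℝ P := by
    simp only [hP, Set.ofPred_forall]
    exact convex_iInter fun i => convex_halfSpace_le (a i).isLinear _
  obtain ⟨p, hp, hmin⟩ :=
    exists_norm_eq_iInf_of_complete_convex hne hclosed.isComplete hconv x
  rw [norm_eq_iInf_iff_real_inner_le_zero hconv hp] at hmin
  refine ⟨p, hp, ?_⟩
  set J : Finset ι := Finset.univ.filter fun i => a i p = b i with hJ
  have hpolar : ∀ z, (∀ i ∈ J, a i z ≤ 0) → inner ℝ (x - p) z ≤ 0 := by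
    intro z hz
    have hev : ∀ᶠ ε : ℝ in 𝓝[>] 0, ∀ i, a i (p + ε • z) ≤ b i := by
      refine eventually_all.2 fun i => ?_
      by_cases hi : a i p = b i
      · filter_upwards [self_mem_nhdsWithin] with ε hε
        have := hz i (by simp [hJ, hi])
        have hε : 0 < ε := hε
        simp only [map_add, map_smul, smul_eq_mul]
        nlinarith
      · have hlt : a i (p + (0 : ℝ) • z) < b i := by simpa using lt_of_le_of_ne (hp i) hi
        have hcont : Continuous fun ε : ℝ => a i (p + ε • z) := by fun_prop
        exact ((hcont.tendsto 0).eventually_lt_const hlt |>.filter_mono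
          nhdsWithin_le_nhds).mono fun _ h => h.le
    obtain ⟨ε, hε, hε0⟩ := (hev.and self_mem_nhdsWithin).exists
    have hε0 : 0 < ε := hε0
    have := hmin _ hε
    rw [add_sub_cancel_left, real_inner_smul_right] at this
    exact nonpos_of_mul_nonpos_right this hε0
  refine (hCJ J (x - p) hpolar r hr fun i hi => ?_).trans
    (mul_le_mul_of_nonneg_right
      (Finset.single_le_sum (fun J _ => (hC J).le) (Finset.mem_univ J)) hr)
  have : a i p = b i := (Finset.mem_filter.1 hi).2
  rw [map_sub]
  linarith [hx i]

/-- Hoffman's error bound for a system of linear inequalities in coordinates. -/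
theorem hoffman_error_bound_dotProduct {n : ℕ} {ι : Type*} [Fintype ι] (a : ι → Fin n → ℝ)
    (b : ι → ℝ) (hne : ∃ z, ∀ i, a i ⬝ᵥ z ≤ b i) :
    ∃ C : ℝ, 0 < C ∧ ∀ x r, 0 ≤ r → (∀ i, a i ⬝ᵥ x ≤ b i + r) →
      ∃ p, (∀ i, a i ⬝ᵥ p ≤ b i) ∧ l2norm (x - p) ≤ C * r := by
  have key : ∀ i (z : Fin n → ℝ),
      innerSL ℝ (WithLp.toLp 2 (a i)) (WithLp.toLp 2 z) = a i ⬝ᵥ z := fun i z => by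
    rw [innerSL_apply_apply, EuclideanSpace.inner_toLp_toLp, star_trivial, dotProduct_comm]
  obtain ⟨z, hz⟩ := hne
  obtain ⟨C, hC, h⟩ := hoffman_error_bound
    (fun i => innerSL ℝ (WithLp.toLp 2 (a i) : EuclideanSpace ℝ (Fin n))) b
    ⟨WithLp.toLp 2 z, fun i => (key i z).trans_le (hz i)⟩
  refine ⟨C, hC, fun x r hr hx => ?_⟩
  obtain ⟨p, hp, hxp⟩ := h (WithLp.toLp 2 x) r hr fun i => (key i x).trans_le (hx i)
  refine ⟨p.ofLp, fun i => (key i p.ofLp).symm.trans_le (hp i), ?_⟩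
  rw [EuclideanSpace.norm_eq] at hxp
  simpa [l2norm] using hxp

theorem linfnorm_nonneg {n : ℕ} (x : Fin n → ℝ) : 0 ≤ linfnorm x :=
  Real.iSup_nonneg fun _ => abs_nonneg _

theorem abs_le_linfnorm {n : ℕ} (x : Fin n → ℝ) (i : Fin n) : |x i| ≤ linfnorm x :=
  le_ciSup (f := fun i => |x i|) (Set.finite_range _).bddAbove i

theorem linfnorm_le_iff {n : ℕ} {x : Fin n → ℝ} {t : ℝ} (ht : 0 ≤ t) :
    linfnorm x ≤ t ↔ ∀ i, |x i| ≤ t :=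
  ⟨fun h i => (abs_le_linfnorm x i).trans h, fun h => Real.iSup_le h ht⟩

theorem l1norm_nonneg {n : ℕ} (x : Fin n → ℝ) : 0 ≤ l1norm x :=
  Finset.sum_nonneg fun _ _ => abs_nonneg _

theorem continuous_l1norm {n : ℕ} : Continuous (l1norm : (Fin n → ℝ) → ℝ) := by
  unfold l1norm
  fun_prop

theorem l1norm_smul {n : ℕ} (c : ℝ) (x : Fin n → ℝ) : l1norm (c • x) = |c| * l1norm x := by
  simp [l1norm, Finset.mul_sum, abs_mul]

/-- Hölder's inequality for the pairing of `ℓ_∞` and `ℓ₁`. -/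
theorem dotProduct_le_l1norm {n : ℕ} {z : Fin n → ℝ} (hz : ∀ i, |z i| ≤ 1) (x : Fin n → ℝ) :
    z ⬝ᵥ x ≤ l1norm x :=
  Finset.sum_le_sum fun i _ => by
    refine (le_abs_self _).trans ?_
    rw [abs_mul]
    exact mul_le_of_le_one_left (abs_nonneg _) (hz i)

theorem l1norm_le_iff_forall_sign {n : ℕ} {x : Fin n → ℝ} {t : ℝ} :
    l1norm x ≤ t ↔ ∀ s : Finset (Fin n), (fun i => if i ∈ s then (1 : ℝ) else -1) ⬝ᵥ x ≤ t := by
  refine ⟨fun h s => (dotProduct_le_l1norm (fun i => ?_) x).trans h, fun h => ?_⟩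
  · split_ifs <;> simp
  · convert h (Finset.univ.filter fun i => 0 ≤ x i) using 1
    refine Finset.sum_congr rfl fun i _ => ?_
    by_cases hi : 0 ≤ x i
    · simp [hi, abs_of_nonneg hi]
    · simp [hi, abs_of_neg (not_le.1 hi)]

theorem bestKTerm_nonneg {n : ℕ} (k : ℕ) (x : Fin n → ℝ) : 0 ≤ bestKTerm k x :=
  Real.sInf_nonneg <| by
    rintro _ ⟨u, -, rfl⟩
    exact l1norm_nonneg _

theorem le_bestKTerm {n k : ℕ} {x : Fin n → ℝ} {t : ℝ}
    (h : ∀ u : Fin n → ℝ, (Finset.univ.filter (fun i => u i ≠ 0)).card ≤ k →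
      t ≤ l1norm (x - u)) : t ≤ bestKTerm k x :=
  le_csInf ⟨_, 0, by simp, rfl⟩ <| by
    rintro _ ⟨u, hu, rfl⟩
    exact h u hu

theorem bddAbove_opNormInfToOne {a b : ℕ} (Q : Matrix (Fin a) (Fin b) ℝ) :
    BddAbove {t : ℝ | ∃ x : Fin b → ℝ, linfnorm x ≤ 1 ∧ t = l1norm (Q.mulVec x)} := by
  refine ⟨∑ i, ∑ j, |Q i j|, ?_⟩
  rintro _ ⟨x, hx, rfl⟩
  refine Finset.sum_le_sum fun i _ => ?_
  rw [mulVec, dotProduct]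
  refine (Finset.abs_sum_le_sum_abs _ _).trans (Finset.sum_le_sum fun j _ => ?_)
  rw [abs_mul]
  exact mul_le_of_le_one_right (abs_nonneg _) ((abs_le_linfnorm x j).trans hx)

theorem opNormInfToOne_nonneg {a b : ℕ} (Q : Matrix (Fin a) (Fin b) ℝ) :
    0 ≤ opNormInfToOne Q :=
  Real.sSup_nonneg <| by
    rintro _ ⟨x, -, rfl⟩
    exact l1norm_nonneg _

theorem l1norm_mulVec_le {a b : ℕ} (Q : Matrix (Fin a) (Fin b) ℝ) (x : Fin b → ℝ) {r : ℝ}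
    (hx : ∀ i, |x i| ≤ r) (hr : 0 ≤ r) : l1norm (Q.mulVec x) ≤ opNormInfToOne Q * r := by
  rcases hr.eq_or_lt with rfl | hr
  · have : x = 0 := funext fun i => abs_nonpos_iff.1 (hx i)
    simp [this, l1norm]
  · have h : l1norm (Q.mulVec (r⁻¹ • x)) ≤ opNormInfToOne Q := by
      refine le_csSup (bddAbove_opNormInfToOne Q) ⟨_, ?_, rfl⟩
      refine (linfnorm_le_iff zero_le_one).2 fun i => ?_
      rw [Pi.smul_apply, smul_eq_mul, abs_mul, abs_of_pos (inv_pos.2 hr), inv_mul_eq_div]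
      exact div_le_one_of_le₀ (hx i) hr.le
    rwa [mulVec_smul, l1norm_smul, abs_of_pos (inv_pos.2 hr), inv_mul_eq_div,
      div_le_iff₀ hr] at h

theorem cA_nonneg {m n : ℕ} (A : Matrix (Fin m) (Fin n) ℝ) : 0 ≤ cA A :=
  Real.sSup_nonneg <| by
    rintro _ ⟨g, -, -, rfl⟩
    exact opNormInfToOne_nonneg _

theorem opNormInfToOne_le_cA {m n : ℕ} (A : Matrix (Fin m) (Fin n) ℝ) {g : Fin m → Fin n}
    (hg : Function.Injective g) (hu : IsUnit (A.submatrix id g)) :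
    opNormInfToOne ((A.submatrix id g)⁻¹ * (A * Aᵀ)⁻¹ * A) ≤ cA A := by
  refine le_csSup (Set.Finite.bddAbove ((Set.finite_range fun g : Fin m → Fin n =>
    opNormInfToOne ((A.submatrix id g)⁻¹ * (A * Aᵀ)⁻¹ * A)).subset ?_)) ⟨g, hg, hu, rfl⟩
  rintro _ ⟨g, -, -, rfl⟩
  exact ⟨g, rfl⟩

/-- A matrix of full row rank has an invertible maximal square submatrix. -/
theorem exists_isUnit_submatrix_of_rank_eq {m n : ℕ} {A : Matrix (Fin m) (Fin n) ℝ}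
    (hA : A.rank = m) :
    ∃ g : Fin m → Fin n, Function.Injective g ∧ IsUnit (A.submatrix id g) := by
  obtain ⟨κ, g, hg, hspan, hli⟩ := exists_linearIndependent' ℝ A.col
  have : Fintype κ := Fintype.ofInjective g hg
  have hcard : Fintype.card κ = m := by
    rw [← finrank_span_eq_card hli, hspan, ← rank_eq_finrank_span_cols, hA]
  let e : Fin m ≃ κ := (Fintype.equivFinOfCardEq hcard).symm
  refine ⟨g ∘ e, hg.comp e.injective, linearIndependent_cols_iff_isUnit.1 ?_⟩
  exact hli.comp e e.injective

theorem isUnit_det_mul_transpose_of_rank_eq {m n : ℕ} {A : Matrix (Fin m) (Fin n) ℝ}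
    (hA : A.rank = m) : IsUnit (A * Aᵀ).det := by
  rw [← isUnit_iff_isUnit_det, ← linearIndependent_cols_iff_isUnit]
  rw [linearIndependent_iff_card_eq_finrank_span, Set.finrank, ← rank_eq_finrank_span_cols,
    rank_self_mul_transpose, hA, Fintype.card_fin]

/-- Pairing `A h` with a vector whose image under `Aᵀ` lies in the unit cube. -/
theorem dotProduct_mulVec_le_cA_mul {m n : ℕ} {A : Matrix (Fin m) (Fin n) ℝ} (hA : A.rank = m)
    {u : Fin m → ℝ} (hu : ∀ i, |Aᵀ.mulVec u i| ≤ 1) (h : Fin n → ℝ) {r : ℝ} (hr : 0 ≤ r)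
    (hh : ∀ i, |Aᵀ.mulVec (A.mulVec h) i| ≤ r) :
    u ⬝ᵥ A.mulVec h ≤ cA A * r := by
  obtain ⟨g, hg, hunit⟩ := exists_isUnit_submatrix_of_rank_eq hA
  set B := A.submatrix id g
  have hB : IsUnit B.det := (isUnit_iff_isUnit_det B).1 hunit
  set w := Aᵀ.mulVec (A.mulVec h)
  have hw : B.mulVec ((B⁻¹ * (A * Aᵀ)⁻¹ * A).mulVec w) = A.mulVec h := by
    simp only [w, mulVec_mulVec]
    congr 1
    calc B * (B⁻¹ * (A * Aᵀ)⁻¹ * A * (Aᵀ * A))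
        = (B * B⁻¹) * (((A * Aᵀ)⁻¹ * (A * Aᵀ)) * A) := by simp only [Matrix.mul_assoc]
      _ = A := by
        rw [mul_nonsing_inv _ hB, nonsing_inv_mul _ (isUnit_det_mul_transpose_of_rank_eq hA),
          Matrix.one_mul, Matrix.one_mul]
  calc u ⬝ᵥ A.mulVec h
      = (u ᵥ* B) ⬝ᵥ (B⁻¹ * (A * Aᵀ)⁻¹ * A).mulVec w := by rw [← hw, dotProduct_mulVec]
    _ ≤ l1norm ((B⁻¹ * (A * Aᵀ)⁻¹ * A).mulVec w) := by
        refine dotProduct_le_l1norm (fun i => ?_) _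
        have := hu (g i)
        rwa [mulVec_transpose] at this
    _ ≤ opNormInfToOne (B⁻¹ * (A * Aᵀ)⁻¹ * A) * r := l1norm_mulVec_le _ _ hh hr
    _ ≤ cA A * r := mul_le_mul_of_nonneg_right (opNormInfToOne_le_cA A hg hunit) hr

/-- Under the weak range space property, the `ℓ₁` excess of `x` over any `z` is controlled by the
best `k`-term approximation error of `x` and by `AᵀA (x - z)`. -/
theorem l1norm_le_add_bestKTerm {m n k : ℕ} {A : Matrix (Fin m) (Fin n) ℝ} (hA : A.rank = m)
    (hRSP : WeakRSP A k) (x z : Fin n → ℝ) {r : ℝ} (hr : 0 ≤ r)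
    (hxz : ∀ i, |Aᵀ.mulVec (A.mulVec (x - z)) i| ≤ r) :
    l1norm x ≤ l1norm z + 2 * bestKTerm k x + cA A * r := by
  suffices (l1norm x - l1norm z - cA A * r) / 2 ≤ bestKTerm k x by linarith
  refine le_bestKTerm fun v hv => ?_
  set S₁ := Finset.univ.filter fun i => 0 < v i with hS₁
  set S₂ := Finset.univ.filter fun i => v i < 0 with hS₂
  have hdisj : Disjoint S₁ S₂ := by
    refine Finset.disjoint_filter.2 fun i _ h₁ h₂ => ?_
    exact lt_asymm h₁ h₂
  have hcard : S₁.card + S₂.card ≤ k := by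
    rw [← Finset.card_union_of_disjoint hdisj]
    refine (Finset.card_le_card fun i hi => ?_).trans hv
    rcases Finset.mem_union.1 hi with hi | hi
    · exact Finset.mem_filter.2 ⟨Finset.mem_univ _, (Finset.mem_filter.1 hi).2.ne'⟩
    · exact Finset.mem_filter.2 ⟨Finset.mem_univ _, (Finset.mem_filter.1 hi).2.ne⟩
  obtain ⟨u, hu₁, hu₂, hu₃⟩ := hRSP S₁ S₂ hdisj hcard
  have hu : ∀ i, |Aᵀ.mulVec u i| ≤ 1 := fun i => by
    by_cases h₁ : i ∈ S₁
    · simp [hu₁ i h₁]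
    by_cases h₂ : i ∈ S₂
    · simp [hu₂ i h₂]
    exact hu₃ i h₁ h₂
  have hv1 : Aᵀ.mulVec u ⬝ᵥ v = l1norm v := Finset.sum_congr rfl fun i _ => by
    rcases lt_trichotomy (v i) 0 with h | h | h
    · rw [hu₂ i (by simp [hS₂, h]), abs_of_neg h]; ring
    · simp [h]
    · rw [hu₁ i (by simp [hS₁, h]), abs_of_pos h]; ring
  have hpair : Aᵀ.mulVec u ⬝ᵥ (x - z) ≤ cA A * r := by
    rw [mulVec_transpose, ← dotProduct_mulVec]
    exact dotProduct_mulVec_le_cA_mul hA hu _ hr hxz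
  have hz := dotProduct_le_l1norm hu z
  have hvx := dotProduct_le_l1norm hu (v - x)
  have htri : l1norm x ≤ l1norm v + l1norm (x - v) := by
    rw [l1norm, l1norm, l1norm, ← Finset.sum_add_distrib]
    refine Finset.sum_le_sum fun i _ => ?_
    simpa using abs_add_le (v i) (x i - v i)
  have hsymm : l1norm (v - x) = l1norm (x - v) :=
    Finset.sum_congr rfl fun i _ => abs_sub_comm _ _
  rw [dotProduct_sub] at hpair hvx
  linarith

/-- The `ℓ₁` norm attains its minimum on every nonempty closed set. -/
theorem exists_forall_l1norm_le {n : ℕ} {F : Set (Fin n → ℝ)} (hF : IsClosed F)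
    (hne : F.Nonempty) : ∃ z ∈ F, ∀ w ∈ F, l1norm z ≤ l1norm w := by
  obtain ⟨z₀, hz₀⟩ := hne
  refine continuous_l1norm.continuousOn.exists_isMinOn' hF hz₀ (Filter.Eventually.filter_mono
    inf_le_left ?_)
  filter_upwards [(isCompact_closedBall (0 : Fin n → ℝ) (l1norm z₀)).compl_mem_cocompact]
    with z hz
  by_contra! hlt
  refine hz (mem_closedBall_zero_iff.2 ((pi_norm_le_iff_of_nonneg (l1norm_nonneg _)).2 fun i => ?_))
  exact (Finset.single_le_sum (f := fun i => |z i|) (fun _ _ => abs_nonneg _)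
    (Finset.mem_univ i)).trans hlt.le

/-- The Dantzig selector has an optimal solution. -/
theorem exists_dantzig_minimizer {m n : ℕ} {A : Matrix (Fin m) (Fin n) ℝ} (hA : A.rank = m)
    (y : Fin m → ℝ) {τ : ℝ} (hτ : 0 ≤ τ) :
    ∃ z : Fin n → ℝ, linfnorm (Aᵀ.mulVec (A.mulVec z - y)) ≤ τ ∧
      ∀ w : Fin n → ℝ, linfnorm (Aᵀ.mulVec (A.mulVec w - y)) ≤ τ → l1norm z ≤ l1norm w := by
  refine exists_forall_l1norm_le (F := {z | linfnorm (Aᵀ.mulVec (A.mulVec z - y)) ≤ τ}) ?_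
    ⟨Aᵀ.mulVec ((A * Aᵀ)⁻¹.mulVec y), ?_⟩
  · simp only [linfnorm_le_iff hτ, Set.ofPred_forall]
    refine isClosed_iInter fun i => isClosed_le
      ((continuous_apply i).comp (?_ : Continuous fun z => Aᵀ.mulVec (A.mulVec z - y))).abs
      continuous_const
    fun_prop
  · rw [Set.mem_ofPred_eq, mulVec_mulVec, mulVec_mulVec,
      mul_nonsing_inv _ (isUnit_det_mul_transpose_of_rank_eq hA), one_mulVec, sub_self,
      mulVec_zero]
    exact (linfnorm_le_iff hτ).2 fun i => by simpa using hτ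

/-- Corollary 3.4(i): stability of the standard Dantzig selector
`min {‖z‖₁ : ‖Aᵀ(Az − y)‖_∞ ≤ τ}` under the weak RSP of order `k` of `Aᵀ`. -/
theorem standard_DS_stability (m n k : ℕ) (hmn : m < n)
    (A : Matrix (Fin m) (Fin n) ℝ) (hArank : A.rank = m)
    (y : Fin m → ℝ) (τ : ℝ) (hτ : 0 ≤ τ) (hRSP : WeakRSP A k) :
    ∃ γ : ℝ, 0 < γ ∧
      ∀ x : Fin n → ℝ, ∃ xstar : Fin n → ℝ,
        (linfnorm (Aᵀ.mulVec (A.mulVec xstar - y)) ≤ τ ∧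
          ∀ z : Fin n → ℝ, linfnorm (Aᵀ.mulVec (A.mulVec z - y)) ≤ τ →
            l1norm xstar ≤ l1norm z) ∧
        l2norm (x - xstar) ≤
          γ * (max (linfnorm (Aᵀ.mulVec (A.mulVec x - y)) - τ) 0
                + 2 * bestKTerm k x + cA A * τ
                + cA A * linfnorm (Aᵀ.mulVec (A.mulVec x - y))) ∧
        (linfnorm (Aᵀ.mulVec (A.mulVec x - y)) ≤ τ →
          l2norm (x - xstar) ≤ 2 * γ * (bestKTerm k x + cA A * τ)) := by
  obtain ⟨z₀, hz₀, hmin⟩ := exists_dantzig_minimizer hArank y hτ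
  have hbox : ∀ (z : Fin n → ℝ) (t : ℝ), (∀ i, |Aᵀ.mulVec (A.mulVec z - y) i| ≤ t) ↔
      ∀ i, (Aᵀ * A) i ⬝ᵥ z ≤ Aᵀ.mulVec y i + t ∧ -(Aᵀ * A) i ⬝ᵥ z ≤ -Aᵀ.mulVec y i + t := by
    refine fun z t => forall_congr' fun i => ?_
    have : Aᵀ.mulVec (A.mulVec z - y) i = (Aᵀ * A) i ⬝ᵥ z - Aᵀ.mulVec y i := by
      rw [mulVec_sub, mulVec_mulVec]; rfl
    rw [this, neg_dotProduct, abs_le]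
    constructor <;> rintro ⟨h₁, h₂⟩ <;> constructor <;> linarith
  obtain ⟨γ, hγ, hH⟩ := hoffman_error_bound_dotProduct
    (Sum.elim (fun i => (Aᵀ * A) i) (Sum.elim (fun i => -(Aᵀ * A) i)
      (fun (s : Finset (Fin n)) i => if i ∈ s then (1 : ℝ) else -1)))
    (Sum.elim (fun i => Aᵀ.mulVec y i + τ) (Sum.elim (fun i => -Aᵀ.mulVec y i + τ)
      (fun _ => l1norm z₀)))
    ⟨z₀, by
      have h := (hbox z₀ τ).1 ((linfnorm_le_iff hτ).1 hz₀)
      rintro (i | i | s)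
      exacts [(h i).1, (h i).2, l1norm_le_iff_forall_sign.1 le_rfl s]⟩
  refine ⟨γ, hγ, fun x => ?_⟩
  set ρ := linfnorm (Aᵀ.mulVec (A.mulVec x - y)) with hρ
  have hρ0 : 0 ≤ ρ := linfnorm_nonneg _
  have hc := cA_nonneg A
  have hσ := bestKTerm_nonneg k x
  have hcτ := mul_nonneg hc hτ
  have hcρ := mul_nonneg hc hρ0
  have hmax := le_max_left (ρ - τ) 0
  have hmax0 := le_max_right (ρ - τ) 0
  have hl1 : l1norm x ≤ l1norm z₀ + 2 * bestKTerm k x + cA A * (ρ + τ) := by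
    refine l1norm_le_add_bestKTerm hArank hRSP x z₀ (by positivity) fun i => ?_
    have heq : Aᵀ.mulVec (A.mulVec (x - z₀)) i =
        Aᵀ.mulVec (A.mulVec x - y) i - Aᵀ.mulVec (A.mulVec z₀ - y) i := by
      rw [← Pi.sub_apply, ← mulVec_sub, sub_sub_sub_cancel_right, ← mulVec_sub]
    rw [heq]
    exact (abs_sub _ _).trans
      (add_le_add (abs_le_linfnorm _ i) ((abs_le_linfnorm _ i).trans hz₀))
  obtain ⟨p, hp, hxp⟩ := hH x (max (ρ - τ) 0 + 2 * bestKTerm k x + cA A * τ + cA A * ρ)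
    (by positivity) (by
      have h := (hbox x ρ).1 ((linfnorm_le_iff hρ0).1 le_rfl)
      rintro (i | i | s)
      · have := (h i).1
        simp only [Sum.elim_inl]
        linarith
      · have := (h i).2
        simp only [Sum.elim_inl, Sum.elim_inr]
        linarith
      · have := l1norm_le_iff_forall_sign.1 hl1 s
        simp only [Sum.elim_inr]
        linarith)
  refine ⟨p, ⟨?_, fun z hz => ?_⟩, hxp, fun hle => hxp.trans ?_⟩
  · exact (linfnorm_le_iff hτ).2 ((hbox p τ).2 fun i => ⟨hp (.inl i), hp (.inr (.inl i))⟩)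
  · exact (l1norm_le_iff_forall_sign.2 fun s => hp (.inr (.inr s))).trans (hmin z hz)
  · rw [max_eq_right (by linarith), mul_comm 2 γ, mul_assoc]
    refine mul_le_mul_of_nonneg_left ?_ hγ.le
    linarith [mul_le_mul_of_nonneg_left hle hc]
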